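/- There exists an absolute constant c > 0 such that for every positive integer n, every ε ∈ (0,1/6), and every α ∈ ((√n·ε²)^{−1}, ε) (under the implicit assumption that (√n·ε²)^{−1} < ε), there exist a prediction distribution p̂ on [n] and a family of pairs of distributions (p, q) on [n] with tv(p − p̂) ≤ α, such that any algorithm that, given p̂ and samples from p and q, outputs a valid answer of an (α, ε, 11/24)-augmented closeness tester on all these pairs must use at least c·n^{2/3}·α^{1/3}/ε^{4/3} samples. -/

import Mathlib

open Finset

/-- The three possible outputs of an augmented tester. -/
inductive Outcome where
  | accept
  | reject
  | inaccurate
deriving DecidableEq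

instance : Fintype Outcome where
  elems := {Outcome.accept, Outcome.reject, Outcome.inaccurate}
  complete := fun x => by cases x <;> simp

/-- `p` is a probability distribution on `Fin n`. -/
def IsDist {n : ℕ} (p : Fin n → ℝ) : Prop :=
  (∀ i, 0 ≤ p i) ∧ ∑ i, p i = 1

/-- Total variation distance `(1/2)·Σᵢ |pᵢ − qᵢ|`. -/
noncomputable def tv {n : ℕ} (p q : Fin n → ℝ) : ℝ :=
  (∑ i, |p i - q i|) / 2

/-- Probability that the randomized algorithm `A`, fed `s` i.i.d. samples from `p`
and `s` i.i.d. samples from `q`, outputs outcome `o`. -/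
noncomputable def outProb2 {n s : ℕ} (p q : Fin n → ℝ)
    (A : (Fin s → Fin n) → (Fin s → Fin n) → Outcome → ℝ) (o : Outcome) : ℝ :=
  ∑ x : Fin s → Fin n, ∑ y : Fin s → Fin n,
    (∏ j, p (x j)) * (∏ j, q (y j)) * A x y o

/-- `A` (which takes the description of the prediction `phat` as input, together
with `s` samples from each of the two unknown distributions `p` and `q`) is an
`(α, ε, δ)`-augmented closeness tester: for every prediction `phat` and every pair
of distributions `p, q` on `Fin n`, (i) if `tv(phat − p) ≤ α` it outputs
`inaccurate` with probability at most `δ/2`; (ii) if `p = q` it outputs `reject`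
with probability at most `δ/2`; (iii) if `tv(p − q) > ε` it outputs `accept` with
probability at most `δ/2`. -/
def IsAugClosenessTester {n s : ℕ} (α ε δ : ℝ)
    (A : (Fin n → ℝ) → (Fin s → Fin n) → (Fin s → Fin n) → Outcome → ℝ) : Prop :=
  (∀ phat x y o, 0 ≤ A phat x y o) ∧ (∀ phat x y, ∑ o, A phat x y o = 1) ∧
  ∀ phat p q : Fin n → ℝ, IsDist phat → IsDist p → IsDist q →
    (tv phat p ≤ α → outProb2 p q (A phat) Outcome.inaccurate ≤ δ / 2) ∧
    (p = q → outProb2 p q (A phat) Outcome.reject ≤ δ / 2) ∧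
    (ε < tv p q → outProb2 p q (A phat) Outcome.accept ≤ δ / 2)

/-! ### A single block -/

/-- The sign of a Boolean, as a real number. -/
def boolSign (b : Bool) : ℝ := if b then 1 else -1

lemma boolSign_true : boolSign true = 1 := rfl

lemma boolSign_false : boolSign false = -1 := rfl

lemma boolSign_mul_self (b : Bool) : boolSign b * boolSign b = 1 := by
  cases b <;> norm_num [boolSign]

lemma abs_boolSign (b : Bool) : |boolSign b| = 1 := by
  cases b <;> norm_num [boolSign]

lemma abs_mul_boolSign_mul (e : ℝ) (a b : Bool) : |e * boolSign a * boolSign b| = |e| := by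
  rw [abs_mul, abs_mul, abs_boolSign, abs_boolSign, mul_one, mul_one]

/-- Likelihood ratio, with respect to the uniform distribution, of a sample of a light block in
which the `j`-th observation is perturbed by `e j`, averaged over the perturbation signs. -/
noncomputable def lightLik {T : Type*} [Fintype T] {L : ℕ} (e : T → ℝ)
    (c : T → Fin L × Bool) : ℝ :=
  (∑ σ : Fin L → Bool, ∏ j, (1 + e j * boolSign (σ (c j).1) * boolSign (c j).2)) / 2 ^ L

/-- Likelihood ratio, with respect to the uniform distribution, of a sample of a heavy block. -/
noncomputable def heavyLik {T : Type*} [Fintype T] {L : ℕ} (c : T → Fin L × Bool) : ℝ :=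
  (∑ h : Fin L, ∏ j, (((if (c j).1 = h then (L : ℝ) else 0) + 1) / 2)) / L

section Block

variable {T : Type*} [Fintype T] {L : ℕ}

lemma card_sum_one (L : ℕ) : (∑ _σ : Fin L → Bool, (1 : ℝ)) = 2 ^ L := by
  simp

lemma lightLik_zero (c : T → Fin L × Bool) : lightLik (0 : T → ℝ) c = 1 := by
  simp [lightLik]

lemma lightLik_eq_one_of_injective (e : T → ℝ) (c : T → Fin L × Bool)
    (hc : Function.Injective fun j => (c j).1) : lightLik e c = 1 := by
  classical
  unfold lightLik
  rw [div_eq_one_iff_eq (by positivity)]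
  have h1 : ∀ σ : Fin L → Bool,
      ∏ j, (1 + e j * boolSign (σ (c j).1) * boolSign (c j).2)
        = ∏ l : Fin L, ∏ j : {j // (c j).1 = l},
          (1 + e j * boolSign (σ l) * boolSign (c j).2) := by
    intro σ
    rw [← Fintype.prod_fiberwise (fun j => (c j).1)]
    refine Finset.prod_congr rfl fun l _ => Finset.prod_congr rfl fun j _ => ?_
    rw [j.2]
  simp_rw [h1]
  rw [← Fintype.prod_sum fun (l : Fin L) (b : Bool) => ∏ j : {j // (c j).1 = l},
          (1 + e j * boolSign b * boolSign (c j).2)]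
  rw [Finset.prod_congr rfl (g := fun _ => (2 : ℝ))]
  · simp
  intro l _
  by_cases hl : ∃ j, (c j).1 = l
  · obtain ⟨j, hj⟩ := hl
    let _ : Unique {j // (c j).1 = l} :=
      ⟨⟨⟨j, hj⟩⟩, fun i => Subtype.ext (hc (i.2.trans hj.symm))⟩
    simp only [Fintype.prod_unique, Fintype.sum_bool]
    rw [boolSign_true, boolSign_false]
    ring
  · have : IsEmpty {j // (c j).1 = l} := ⟨fun j => hl ⟨j.1, j.2⟩⟩
    simp only [Finset.univ_eq_empty, Finset.prod_empty, Fintype.sum_bool]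
    norm_num

lemma heavyLik_pos (hL : 0 < L) (c : T → Fin L × Bool) : 0 < heavyLik c := by
  have : Nonempty (Fin L) := ⟨⟨0, hL⟩⟩
  unfold heavyLik
  refine div_pos (Finset.sum_pos (fun h _ => Finset.prod_pos fun j _ => ?_) Finset.univ_nonempty)
    (by exact_mod_cast hL)
  split_ifs <;> positivity

lemma le_heavyLik_of_not_injective (hL : 0 < L) (c : T → Fin L × Bool)
    (hc : ¬ Function.Injective fun j => (c j).1) :
    (L : ℝ) / 2 ^ Fintype.card T ≤ heavyLik c := by
  classical
  have hL' : (0 : ℝ) < L := by exact_mod_cast hL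
  rw [Function.Injective] at hc
  push Not at hc
  obtain ⟨j, k, hjk, hne⟩ := hc
  have hnn : ∀ h : Fin L, ∀ i, 1 ≤ ((if (c i).1 = h then (L : ℝ) else 0) + 1) := by
    intro h i; split_ifs <;> linarith
  unfold heavyLik
  rw [le_div_iff₀ hL']
  refine le_trans ?_ (Finset.single_le_sum (f := fun h : Fin L =>
    ∏ j, (((if (c j).1 = h then (L : ℝ) else 0) + 1) / 2))
    (fun h _ => Finset.prod_nonneg fun i _ => by linarith [hnn h i])
    (Finset.mem_univ (c j).1))
  rw [Finset.prod_div_distrib, Finset.prod_const, Finset.card_univ, div_mul_eq_mul_div]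
  refine div_le_div_of_nonneg_right ?_ (by positivity)
  rw [← Finset.mul_prod_erase _ _ (Finset.mem_univ j),
    ← Finset.mul_prod_erase _ _ (Finset.mem_erase.2 ⟨hne.symm, Finset.mem_univ k⟩)]
  have h1 : (1 : ℝ) ≤ ∏ x ∈ (Finset.univ.erase j).erase k,
      ((if (c x).1 = (c j).1 then (L : ℝ) else 0) + 1) := by
    have := Finset.prod_le_prod (s := (Finset.univ.erase j).erase k) (f := fun _ => (1 : ℝ))
      (g := fun x => ((if (c x).1 = (c j).1 then (L : ℝ) else 0) + 1))
      (fun _ _ => zero_le_one) (fun i _ => hnn _ i)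
    simpa using this
  rw [if_pos rfl, if_pos hjk.symm, ← mul_assoc]
  nlinarith [mul_pos hL' hL', h1]

variable [DecidableEq T]

lemma sum_heavyLik (hL : 0 < L) :
    ∑ c : T → Fin L × Bool, heavyLik c = (2 * L : ℝ) ^ Fintype.card T := by
  have hL' : (0 : ℝ) < L := by exact_mod_cast hL
  unfold heavyLik
  rw [← Finset.sum_div, Finset.sum_comm]
  rw [Finset.sum_congr rfl (g := fun _ => (2 * L : ℝ) ^ Fintype.card T)]
  · simp; field_simp
  intro h _
  rw [← Fintype.prod_sum fun (_ : T) (c : Fin L × Bool) =>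
    ((if c.1 = h then (L : ℝ) else 0) + 1) / 2]
  rw [Finset.prod_const, Finset.card_univ, Fintype.sum_prod_type]
  congr 1
  simp only [Fintype.sum_bool, ← Finset.sum_div, Finset.sum_add_distrib, Finset.sum_ite_eq',
    Finset.mem_univ, if_true]
  simp
  ring

lemma sum_one_add_sign (e : ℝ) (σ : Fin L → Bool) :
    ∑ c : Fin L × Bool, (1 + e * boolSign (σ c.1) * boolSign c.2) = 2 * L := by
  rw [Fintype.sum_prod_type]
  simp only [Fintype.sum_bool, boolSign]
  simp [Finset.sum_add_distrib]
  ring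

lemma sum_one_add_sign_mul (e : ℝ) (σ τ : Fin L → Bool) :
    ∑ c : Fin L × Bool, (1 + e * boolSign (σ c.1) * boolSign c.2) *
      (1 + e * boolSign (τ c.1) * boolSign c.2)
      = 2 * L + 2 * e ^ 2 * ∑ l, boolSign (σ l) * boolSign (τ l) := by
  rw [Fintype.sum_prod_type, Finset.mul_sum]
  have : (2 * L : ℝ) = ∑ _l : Fin L, (2 : ℝ) := by simp; ring
  rw [this, ← Finset.sum_add_distrib]
  refine Finset.sum_congr rfl fun l _ => ?_
  rw [Fintype.sum_bool, boolSign_true, boolSign_false]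
  ring

lemma sum_lightLik (e : T → ℝ) :
    ∑ c : T → Fin L × Bool, lightLik e c = (2 * L : ℝ) ^ Fintype.card T := by
  unfold lightLik
  rw [← Finset.sum_div, Finset.sum_comm]
  rw [Finset.sum_congr rfl (g := fun _ => (2 * L : ℝ) ^ Fintype.card T)]
  · simp
  intro σ _
  rw [← Fintype.prod_sum fun (j : T) (c : Fin L × Bool) =>
    (1 + e j * boolSign (σ c.1) * boolSign c.2)]
  simp_rw [sum_one_add_sign]
  simp

lemma prod_one_add_mul_le {ι : Type*} [DecidableEq ι] (s : Finset ι) (a : ι → ℝ) (b t : ℝ) (ha : ∀ j, 0 ≤ a j)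
    (hab : ∀ j, a j ≤ b) (hb0 : 0 ≤ b) (hb : b ≤ 1) (ht : |t| ≤ 1) :
    ∏ j ∈ s, (1 + a j * t) ≤ 1 + (∑ j ∈ s, a j) * t + 3 ^ s.card * b ^ 2 * t ^ 2 := by
  suffices h : (∏ j ∈ s, (1 + a j * t) ≤
      1 + (∑ j ∈ s, a j) * t + 3 ^ s.card * b ^ 2 * t ^ 2) ∧ ∑ j ∈ s, a j ≤ 3 ^ s.card * b from h.1
  induction s using Finset.induction_on with
  | empty => simp only [Finset.prod_empty, Finset.sum_empty, Finset.card_empty]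
             constructor <;> nlinarith [mul_nonneg (sq_nonneg b) (sq_nonneg t)]
  | insert i s hi ih =>
    rw [Finset.prod_insert hi, Finset.sum_insert hi, Finset.card_insert_of_notMem hi]
    obtain ⟨ih1, ih2⟩ := ih
    obtain ⟨ht1, ht2⟩ := abs_le.1 ht
    have hS : 0 ≤ ∑ j ∈ s, a j := Finset.sum_nonneg fun j _ => ha j
    set S := ∑ j ∈ s, a j
    have hB : (1 : ℝ) ≤ 3 ^ s.card := one_le_pow₀ (by norm_num)
    set B : ℝ := 3 ^ s.card
    have hai := ha i
    have habi := hab i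
    set A := a i
    constructor
    · have h1 : 0 ≤ 1 + A * t := by nlinarith
      have h2 : A * S ≤ B * b ^ 2 := by nlinarith [mul_le_mul habi ih2 hS hb0]
      have h3 : A * (B * b ^ 2) * t ≤ B * b ^ 2 := by
        have : A * t ≤ 1 := by nlinarith
        nlinarith [mul_le_mul_of_nonneg_right this (by positivity : 0 ≤ B * b ^ 2)]
      calc (1 + A * t) * ∏ j ∈ s, (1 + a j * t)
          ≤ (1 + A * t) * (1 + S * t + B * b ^ 2 * t ^ 2) := mul_le_mul_of_nonneg_left ih1 h1
        _ = 1 + (A + S) * t + (A * S + B * b ^ 2 + A * (B * b ^ 2) * t) * t ^ 2 := by ring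
        _ ≤ 1 + (A + S) * t + (3 * (B * b ^ 2)) * t ^ 2 := by
          gcongr; linarith
        _ = _ := by rw [pow_succ]; ring
    · rw [pow_succ]; nlinarith

lemma sum_boolSign_mul_boolSign {l m : Fin L} (h : l ≠ m) :
    ∑ σ : Fin L → Bool, boolSign (σ l) * boolSign (σ m) = 0 := by
  have hinv : Function.Involutive fun σ : Fin L → Bool => Function.update σ l (!σ l) := by
    intro σ; simp
  have := Equiv.sum_comp hinv.toPerm fun σ : Fin L → Bool => boolSign (σ l) * boolSign (σ m)
  have h2 : ∀ b, boolSign (!b) = - boolSign b := by intro b; cases b <;> simp [boolSign]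
  simp only [Function.Involutive.coe_toPerm, Function.update_self,
    Function.update_of_ne h.symm, h2, neg_mul, Finset.sum_neg_distrib] at this
  linarith

lemma sum_boolSign (l : Fin L) : ∑ σ : Fin L → Bool, boolSign (σ l) = 0 := by
  have hinv : Function.Involutive fun σ : Fin L → Bool => Function.update σ l (!σ l) := by
    intro σ; simp
  have := Equiv.sum_comp hinv.toPerm fun σ : Fin L → Bool => boolSign (σ l)
  have h2 : ∀ b, boolSign (!b) = - boolSign b := by intro b; cases b <;> simp [boolSign]
  simp only [Function.Involutive.coe_toPerm, Function.update_self, h2,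
    Finset.sum_neg_distrib] at this
  linarith

lemma sum_sum_boolSign_mul (τ : Fin L → Bool) :
    ∑ σ : Fin L → Bool, ∑ l, boolSign (σ l) * boolSign (τ l) = 0 := by
  rw [Finset.sum_comm]
  simp_rw [← Finset.sum_mul, sum_boolSign]
  simp

lemma sum_sum_boolSign_mul_sq (τ : Fin L → Bool) :
    ∑ σ : Fin L → Bool, (∑ l, boolSign (σ l) * boolSign (τ l)) ^ 2 = 2 ^ L * L := by
  simp_rw [sq, Finset.sum_mul_sum]
  rw [Finset.sum_comm]
  rw [Finset.sum_congr rfl (g := fun _ => (2 : ℝ) ^ L)]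
  · simp; ring
  intro l _
  rw [Finset.sum_comm, Finset.sum_eq_single l]
  · rw [← card_sum_one]
    refine Finset.sum_congr rfl fun σ _ => ?_
    have h1 := boolSign_mul_self (σ l)
    have h2 := boolSign_mul_self (τ l)
    calc _ = (boolSign (σ l) * boolSign (σ l)) * (boolSign (τ l) * boolSign (τ l)) := by ring
      _ = 1 := by rw [h1, h2, one_mul]
  · intro m _ hm
    calc _ = ∑ σ : Fin L → Bool,
          (boolSign (τ l) * boolSign (τ m)) * (boolSign (σ l) * boolSign (σ m)) :=
          Finset.sum_congr rfl fun σ _ => by ring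
      _ = 0 := by rw [← Finset.mul_sum, sum_boolSign_mul_boolSign hm.symm, mul_zero]
  · simp

lemma abs_sum_boolSign_mul_div_le (hL : 0 < L) (σ τ : Fin L → Bool) :
    |(∑ l, boolSign (σ l) * boolSign (τ l)) / L| ≤ 1 := by
  have hL' : (0 : ℝ) < L := by exact_mod_cast hL
  rw [abs_div, abs_of_pos hL', div_le_one hL']
  refine (Finset.abs_sum_le_sum_abs _ _).trans ?_
  simp [abs_mul, abs_boolSign]

lemma sum_lightLik_sq_le (hL : 0 < L) (e : T → ℝ) (η : ℝ) (hη : η ≤ 1) (he : ∀ j, |e j| ≤ η)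
    (hη0 : 0 ≤ η) :
    ∑ c : T → Fin L × Bool, lightLik e c ^ 2
      ≤ (2 * L : ℝ) ^ Fintype.card T * (1 + 3 ^ Fintype.card T * η ^ 4 / L) := by
  have hL' : (0 : ℝ) < L := by exact_mod_cast hL
  have h2 : ∀ j, e j ^ 2 ≤ η ^ 2 := fun j => sq_le_sq' (abs_le.1 (he j)).1 (abs_le.1 (he j)).2
  have key : ∑ c : T → Fin L × Bool, lightLik e c ^ 2 =
      (2 * L : ℝ) ^ Fintype.card T * ((∑ σ : Fin L → Bool, ∑ τ : Fin L → Bool,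
        ∏ j, (1 + e j ^ 2 * ((∑ l, boolSign (σ l) * boolSign (τ l)) / L))) / (2 ^ L * 2 ^ L)) := by
    unfold lightLik
    simp_rw [sq, div_mul_div_comm, Finset.sum_mul_sum, ← Finset.prod_mul_distrib]
    rw [← Finset.sum_div, mul_div_assoc', Finset.sum_comm, Finset.mul_sum]
    congr 1
    refine Finset.sum_congr rfl fun σ _ => ?_
    rw [Finset.sum_comm, Finset.mul_sum]
    refine Finset.sum_congr rfl fun τ _ => ?_
    rw [← Fintype.prod_sum fun (j : T) (c : Fin L × Bool) =>
      (1 + e j * boolSign (σ c.1) * boolSign c.2) * (1 + e j * boolSign (τ c.1) * boolSign c.2)]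
    simp_rw [sum_one_add_sign_mul]
    rw [← Finset.card_univ, ← Finset.prod_const, ← Finset.prod_mul_distrib]
    refine Finset.prod_congr rfl fun j _ => ?_
    field_simp
  rw [key]
  refine mul_le_mul_of_nonneg_left ?_ (by positivity)
  rw [div_le_iff₀ (by positivity)]
  set S := ∑ j, e j ^ 2
  calc ∑ σ : Fin L → Bool, ∑ τ : Fin L → Bool,
        ∏ j, (1 + e j ^ 2 * ((∑ l, boolSign (σ l) * boolSign (τ l)) / L))
      ≤ ∑ σ : Fin L → Bool, ∑ τ : Fin L → Bool,
        (1 + S * ((∑ l, boolSign (σ l) * boolSign (τ l)) / L) +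
          3 ^ Fintype.card T * (η ^ 2) ^ 2 *
            ((∑ l, boolSign (σ l) * boolSign (τ l)) / L) ^ 2) := by
        refine Finset.sum_le_sum fun σ _ => Finset.sum_le_sum fun τ _ => ?_
        exact prod_one_add_mul_le Finset.univ (fun j => e j ^ 2) (η ^ 2) _ (fun j => sq_nonneg _)
          h2 (sq_nonneg _) (pow_le_one₀ hη0 hη) (abs_sum_boolSign_mul_div_le hL σ τ)
    _ = (1 + 3 ^ Fintype.card T * η ^ 4 / L) * (2 ^ L * 2 ^ L) := by
        rw [Finset.sum_comm]
        rw [Finset.sum_congr rfl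
          (g := fun _ => (1 + 3 ^ Fintype.card T * η ^ 4 / L) * (2 : ℝ) ^ L)]
        · simp; ring
        intro τ _
        rw [Finset.sum_add_distrib, Finset.sum_add_distrib, ← Finset.mul_sum, ← Finset.mul_sum]
        simp_rw [div_pow]
        rw [← Finset.sum_div, ← Finset.sum_div, sum_sum_boolSign_mul, sum_sum_boolSign_mul_sq,
          card_sum_one]
        field_simp
        ring

end Block

/-- State of a block: either light (`none`) or heavy at some pair of cells, together with the signs
used to perturb the block when it is light. -/
abbrev BlockState (L : ℕ) := Option (Fin L) × (Fin L → Bool)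

/-- Prior probability of a block state, where a block is heavy with probability `ρ`. -/
noncomputable def stateWt {L : ℕ} (ρ : ℝ) (θ : BlockState L) : ℝ :=
  θ.1.elim (1 - ρ) (fun _ => ρ / L) / 2 ^ L

/-- Conditional mass of a cell within its block, with light blocks perturbed by `e`. -/
noncomputable def cellMass {L : ℕ} (e : ℝ) (θ : BlockState L) (c : Fin L × Bool) : ℝ :=
  θ.1.elim (1 + e * boolSign (θ.2 c.1) * boolSign c.2)
    (fun h => ((if c.1 = h then (L : ℝ) else 0) + 1) / 2) / (2 * L)

/-- Mixture, over the block state, of the law of independent samples in a block. -/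
noncomputable def blockMix {T : Type*} [Fintype T] {L : ℕ} (ρ : ℝ) (e : T → ℝ)
    (c : T → Fin L × Bool) : ℝ :=
  ∑ θ : BlockState L, stateWt ρ θ * ∏ j, cellMass (e j) θ (c j)

lemma stateWt_nonneg {L : ℕ} {ρ : ℝ} (h0 : 0 ≤ ρ) (h1 : ρ ≤ 1) (θ : BlockState L) :
    0 ≤ stateWt ρ θ := by
  obtain ⟨_ | h, σ⟩ := θ
  · exact div_nonneg (sub_nonneg.2 h1) (by positivity)
  · exact div_nonneg (div_nonneg h0 (by positivity)) (by positivity)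

lemma sum_stateWt_mul {L : ℕ} (hL : 0 < L) (ρ a b : ℝ) :
    ∑ θ : BlockState L, stateWt ρ θ * θ.1.elim a (fun _ => b) = (1 - ρ) * a + ρ * b := by
  have hL' : (0 : ℝ) < L := by exact_mod_cast hL
  rw [Fintype.sum_prod_type, Fintype.sum_option]
  simp only [stateWt, Option.elim]
  simp
  field_simp

lemma sum_stateWt {L : ℕ} (hL : 0 < L) (ρ : ℝ) : ∑ θ : BlockState L, stateWt ρ θ = 1 := by
  have := sum_stateWt_mul hL ρ 1 1
  have h : ∀ θ : BlockState L, θ.1.elim (1 : ℝ) (fun _ => 1) = 1 := by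
    rintro ⟨_ | h, σ⟩ <;> rfl
  simp only [h, mul_one] at this
  linarith

lemma cellMass_nonneg {L : ℕ} {e : ℝ} (he : |e| ≤ 1) (θ : BlockState L) (c : Fin L × Bool) :
    0 ≤ cellMass e θ c := by
  obtain ⟨_ | h, σ⟩ := θ
  · have := (abs_le.1 ((abs_mul_boolSign_mul e (σ c.1) c.2).le.trans he)).1
    exact div_nonneg (by simp only [Option.elim]; linarith) (by positivity)
  · refine div_nonneg ?_ (by positivity)
    simp only [Option.elim]
    split_ifs <;> positivity

lemma sum_cellMass {L : ℕ} (hL : 0 < L) (e : ℝ) (θ : BlockState L) :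
    ∑ c : Fin L × Bool, cellMass e θ c = 1 := by
  have hL' : (0 : ℝ) < L := by exact_mod_cast hL
  obtain ⟨_ | h, σ⟩ := θ
  · simp only [cellMass, Option.elim]
    rw [← Finset.sum_div, sum_one_add_sign, div_self (by positivity)]
  · simp only [cellMass, Option.elim]
    rw [← Finset.sum_div, div_eq_one_iff_eq (by positivity), Fintype.sum_prod_type]
    simp only [Fintype.sum_bool, ← Finset.sum_div, Finset.sum_add_distrib, Finset.sum_ite_eq',
      Finset.mem_univ, if_true]
    simp
    ring

section BlockMix

variable {T : Type*} [Fintype T] {L : ℕ}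

lemma blockMix_eq (hL : 0 < L) (ρ : ℝ) (e : T → ℝ) (c : T → Fin L × Bool) :
    blockMix ρ e c =
      ((1 - ρ) * lightLik e c + ρ * heavyLik c) / (2 * L) ^ Fintype.card T := by
  have hL' : (0 : ℝ) < L := by exact_mod_cast hL
  unfold blockMix
  simp only [cellMass, Finset.prod_div_distrib, Finset.prod_const, Finset.card_univ]
  simp_rw [← mul_div_assoc]
  rw [← Finset.sum_div]
  congr 1
  rw [Fintype.sum_prod_type, Fintype.sum_option]
  simp only [stateWt, Option.elim, lightLik, heavyLik]
  congr 1
  · rw [← Finset.mul_sum]; ring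
  · simp only [Finset.sum_const, Finset.card_univ, Fintype.card_pi, Fintype.card_bool,
      Finset.prod_const, Fintype.card_fin, nsmul_eq_mul, Finset.prod_div_distrib]
    rw [← Finset.mul_sum, ← Finset.mul_sum]
    push_cast
    field_simp

lemma blockMix_zero_pos (hL : 0 < L) {ρ : ℝ} (h0 : 0 < ρ) (h1 : ρ ≤ 1)
    (c : T → Fin L × Bool) : 0 < blockMix ρ 0 c := by
  have hL' : (0 : ℝ) < L := by exact_mod_cast hL
  rw [blockMix_eq hL, lightLik_zero]
  have := mul_pos h0 (heavyLik_pos hL c)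
  refine div_pos (by linarith) (by positivity)

/-- Pointwise bound on the `χ²` integrand: the perturbation is only visible on samples having a
collision, and these are also produced by heavy blocks. -/
lemma blockMix_sq_div_le (hL : 0 < L) {ρ : ℝ} (h0 : 0 < ρ) (h1 : ρ ≤ 1) (e : T → ℝ)
    (c : T → Fin L × Bool) :
    blockMix ρ e c ^ 2 / blockMix ρ 0 c ≤
      (((1 - ρ) + ρ * heavyLik c) + 2 * (1 - ρ) * (lightLik e c - 1) +
        2 ^ Fintype.card T / (ρ * L) * (lightLik e c ^ 2 - 2 * lightLik e c + 1))
        / (2 * L) ^ Fintype.card T := by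
  have hL' : (0 : ℝ) < L := by exact_mod_cast hL
  have hH := heavyLik_pos hL c
  rw [blockMix_eq hL, blockMix_eq hL, lightLik_zero]
  set U : ℝ := (2 * L) ^ Fintype.card T with hU
  have hU0 : 0 < U := by positivity
  set H := heavyLik c
  set G := lightLik e c with hG
  set A : ℝ := 2 ^ Fintype.card T
  have hA : 0 < A := by positivity
  have hP : 0 < (1 - ρ) * 1 + ρ * H := by nlinarith
  have hne : 1 - ρ + ρ * H ≠ 0 := by rw [← mul_one (1 - ρ)]; exact hP.ne'
  have : ((((1 - ρ) * G + ρ * H) / U) ^ 2 / (((1 - ρ) * 1 + ρ * H) / U)) =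
      (((1 - ρ) + ρ * H) + 2 * (1 - ρ) * (G - 1) +
        (1 - ρ) ^ 2 * (G - 1) ^ 2 / ((1 - ρ) * 1 + ρ * H)) / U := by
    field_simp
    ring
  rw [this]
  refine div_le_div_of_nonneg_right ?_ hU0.le
  have hsq : G ^ 2 - 2 * G + 1 = (G - 1) ^ 2 := by ring
  rw [hsq]
  refine add_le_add le_rfl ?_
  by_cases hc : Function.Injective fun j => (c j).1
  · rw [hG, lightLik_eq_one_of_injective e c hc]
    simp
  · have hle : L / A ≤ H := le_heavyLik_of_not_injective hL c hc
    have h2 : (1 - ρ) ^ 2 * (G - 1) ^ 2 ≤ (G - 1) ^ 2 :=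
      mul_le_of_le_one_left (sq_nonneg _) (by nlinarith)
    calc (1 - ρ) ^ 2 * (G - 1) ^ 2 / ((1 - ρ) * 1 + ρ * H)
        ≤ (G - 1) ^ 2 / (ρ * (L / A)) := by
          refine div_le_div₀ (sq_nonneg _) h2 (by positivity) ?_
          nlinarith [mul_le_mul_of_nonneg_left hle h0.le]
      _ = A / (ρ * L) * (G - 1) ^ 2 := by field_simp

lemma sum_blockMix_sq_div_le [DecidableEq T] (hL : 0 < L) {ρ : ℝ} (h0 : 0 < ρ) (h1 : ρ ≤ 1)
    (e : T → ℝ) (η : ℝ) (hη0 : 0 ≤ η) (hη : η ≤ 1) (he : ∀ j, |e j| ≤ η) :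
    ∑ c : T → Fin L × Bool, blockMix ρ e c ^ 2 / blockMix ρ 0 c ≤
      1 + η ^ 4 / (ρ * L ^ 2) * 6 ^ Fintype.card T := by
  have hL' : (0 : ℝ) < L := by exact_mod_cast hL
  refine (Finset.sum_le_sum fun c _ => blockMix_sq_div_le hL h0 h1 e c).trans ?_
  rw [← Finset.sum_div, div_le_iff₀ (by positivity)]
  simp only [Finset.sum_add_distrib, ← Finset.mul_sum, Finset.sum_sub_distrib, sum_heavyLik hL,
    sum_lightLik]
  have hone : ∑ _c : T → Fin L × Bool, (1 : ℝ) = (2 * L) ^ Fintype.card T := by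
    simp [mul_comm]
  have hρ : ∑ _c : T → Fin L × Bool, ρ = ρ * (2 * L) ^ Fintype.card T := by
    simp [mul_comm]
  rw [hone, hρ]
  have hG := sum_lightLik_sq_le hL e η hη he hη0
  have h6 : (6 : ℝ) ^ Fintype.card T = 2 ^ Fintype.card T * 3 ^ Fintype.card T := by
    rw [← mul_pow]; norm_num
  rw [h6]
  set U : ℝ := (2 * L) ^ Fintype.card T with hU
  set A : ℝ := 2 ^ Fintype.card T
  set B : ℝ := 3 ^ Fintype.card T
  set G2 := ∑ c : T → Fin L × Bool, lightLik e c ^ 2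
  have hq : 0 ≤ A / (ρ * L) := by positivity
  have : A / (ρ * L) * (G2 - 2 * U + U) ≤ A / (ρ * L) * (U * (B * η ^ 4 / L)) := by
    refine mul_le_mul_of_nonneg_left ?_ hq
    linarith
  calc _ ≤ U - ρ * U + ρ * U + 2 * (1 - ρ) * (U - U) +
        A / (ρ * L) * (U * (B * η ^ 4 / L)) := by linarith
    _ = (1 + η ^ 4 / (ρ * L ^ 2) * (A * B)) * U := by field_simp; ring

end BlockMix

/-! ### Gluing the blocks together -/

/-- Functions on `J` with values in `C` split along the fibers of a map `β`. -/
def fiberPiEquiv {J B C : Type*} (β : J → B) : (J → C) ≃ (∀ b, {j // β j = b} → C) where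
  toFun c b j := c j
  invFun d j := d (β j) ⟨j, rfl⟩
  left_inv _ := rfl
  right_inv d := by
    funext b ⟨j, hj⟩
    subst hj
    rfl

/-- Mixture, over all block states, of the law of independent samples, the `j`-th of which has its
light blocks perturbed by `e j`. -/
noncomputable def totalMix {J : Type*} [Fintype J] {K L : ℕ} (ρ : ℝ) (e : J → ℝ)
    (w : J → Fin K × (Fin L × Bool)) : ℝ :=
  ∑ θ : Fin K → BlockState L, (∏ b, stateWt ρ (θ b)) *
    ∏ j, (cellMass (e j) (θ (w j).1) (w j).2 / K)

section Total

variable {J : Type*} [Fintype J] {K L : ℕ}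

lemma totalMix_eq (ρ : ℝ) (e : J → ℝ) (β : J → Fin K) (c : J → Fin L × Bool) :
    totalMix ρ e (fun j => (β j, c j)) =
      (∏ b, blockMix ρ (fun j : {j // β j = b} => e j) (fun j : {j // β j = b} => c j)) /
        (K : ℝ) ^ Fintype.card J := by
  unfold totalMix blockMix
  rw [Fintype.prod_sum, Finset.sum_div]
  refine Finset.sum_congr rfl fun θ _ => ?_
  rw [Finset.prod_div_distrib, Finset.prod_const, Finset.card_univ, ← mul_div_assoc,
    Finset.prod_mul_distrib, ← Fintype.prod_fiberwise β]
  congr 2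
  refine Finset.prod_congr rfl fun b _ => Finset.prod_congr rfl fun j _ => ?_
  simp only [j.2]

lemma totalMix_zero_pos (hK : 0 < K) (hL : 0 < L) {ρ : ℝ} (h0 : 0 < ρ) (h1 : ρ ≤ 1)
    (w : J → Fin K × (Fin L × Bool)) : 0 < totalMix ρ 0 w := by
  have hK' : (0 : ℝ) < K := by exact_mod_cast hK
  have := totalMix_eq ρ 0 (fun j => (w j).1) (fun j => (w j).2)
  simp only [Prod.mk.eta] at this
  rw [this]
  exact div_pos (Finset.prod_pos fun b _ => blockMix_zero_pos hL h0 h1 _) (by positivity)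

variable [DecidableEq J]

lemma sum_prod_fiber_pow_le (hK : 0 < K) (hJ : Fintype.card J ≤ K) {t : ℝ} (ht : 0 ≤ t) :
    ∑ β : J → Fin K, ∏ b, (1 + t * 6 ^ Fintype.card {j // β j = b})
      ≤ (K : ℝ) ^ Fintype.card J * (1 + t * Real.exp 5) ^ K := by
  have hK' : (0 : ℝ) < K := by exact_mod_cast hK
  simp_rw [Finset.prod_one_add]
  rw [Finset.sum_comm]
  have h1 : ∀ S : Finset (Fin K), ∑ β : J → Fin K,
      ∏ b ∈ S, (t * 6 ^ Fintype.card {j // β j = b})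
      = t ^ S.card * ((K : ℝ) + 5 * S.card) ^ Fintype.card J := by
    intro S
    have h2 : ∀ β : J → Fin K, ∏ b ∈ S, (t * 6 ^ Fintype.card {j // β j = b}) =
        t ^ S.card * ∏ j, (if β j ∈ S then (6 : ℝ) else 1) := by
      intro β
      rw [Finset.prod_mul_distrib, Finset.prod_const]
      congr 1
      rw [← Fintype.prod_fiberwise β, ← Finset.prod_subset (Finset.subset_univ S)]
      · refine Finset.prod_congr rfl fun b hb => ?_
        rw [← Finset.card_univ, ← Finset.prod_const]
        refine Finset.prod_congr rfl fun j _ => ?_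
        rw [if_pos (by rw [j.2]; exact hb)]
      · intro b _ hb
        refine Finset.prod_eq_one fun j _ => ?_
        rw [if_neg (by rw [j.2]; exact hb)]
    simp_rw [h2]
    rw [← Finset.mul_sum, ← Fintype.prod_sum fun (_ : J) (b : Fin K) =>
      if b ∈ S then (6 : ℝ) else 1]
    rw [Finset.prod_const, Finset.card_univ]
    congr 2
    have h3 : ∀ b : Fin K, (if b ∈ S then (6 : ℝ) else 1) = 1 + 5 * (if b ∈ S then 1 else 0) := by
      intro b; split_ifs <;> norm_num
    simp_rw [h3]
    rw [Finset.sum_add_distrib, ← Finset.mul_sum]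
    simp
  simp_rw [h1]
  have h4 : ∀ S : Finset (Fin K), t ^ S.card * ((K : ℝ) + 5 * S.card) ^ Fintype.card J ≤
      (K : ℝ) ^ Fintype.card J * ∏ _b ∈ S, (t * Real.exp 5) := by
    intro S
    rw [Finset.prod_const, mul_pow]
    have h5 : (K : ℝ) + 5 * S.card ≤ K * Real.exp (5 * S.card / K) := by
      have := Real.add_one_le_exp (5 * S.card / K : ℝ)
      calc (K : ℝ) + 5 * S.card = K * (5 * S.card / K + 1) := by field_simp; ring
        _ ≤ _ := by gcongr
    have h6 : ((K : ℝ) + 5 * S.card) ^ Fintype.card J ≤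
        (K : ℝ) ^ Fintype.card J * Real.exp 5 ^ S.card := by
      refine (pow_le_pow_left₀ (by positivity) h5 _).trans ?_
      rw [mul_pow, ← Real.exp_nat_mul, ← Real.exp_nat_mul]
      refine mul_le_mul_of_nonneg_left (Real.exp_le_exp.2 ?_) (by positivity)
      have hJ' : (Fintype.card J : ℝ) / K ≤ 1 := by
        rw [div_le_one hK']; exact_mod_cast hJ
      calc (Fintype.card J : ℝ) * (5 * S.card / K) = (Fintype.card J / K) * (S.card * 5) := by ring
        _ ≤ 1 * (S.card * 5) := by gcongr
        _ = _ := one_mul _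
    calc _ ≤ t ^ S.card * ((K : ℝ) ^ Fintype.card J * Real.exp 5 ^ S.card) := by gcongr
      _ = _ := by ring
  calc _ ≤ ∑ S ∈ Finset.univ.powerset,
        (K : ℝ) ^ Fintype.card J * ∏ _b ∈ S, (t * Real.exp 5) :=
        Finset.sum_le_sum fun S _ => h4 S
    _ = _ := by
      rw [← Finset.mul_sum, ← Finset.prod_one_add, Finset.prod_const, Finset.card_univ,
        Fintype.card_fin]

lemma sum_totalMix_sq_div_le (hK : 0 < K) (hL : 0 < L) (hJ : Fintype.card J ≤ K) {ρ : ℝ}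
    (h0 : 0 < ρ) (h1 : ρ ≤ 1) (e : J → ℝ) (η : ℝ) (hη0 : 0 ≤ η) (hη : η ≤ 1)
    (he : ∀ j, |e j| ≤ η) :
    ∑ w : J → Fin K × (Fin L × Bool), totalMix ρ e w ^ 2 / totalMix ρ 0 w ≤
      (1 + η ^ 4 / (ρ * L ^ 2) * Real.exp 5) ^ K := by
  have hK' : (0 : ℝ) < K := by exact_mod_cast hK
  set t := η ^ 4 / (ρ * L ^ 2) with ht
  have ht0 : 0 ≤ t := by positivity
  rw [← (Equiv.arrowProdEquivProdArrow J (fun _ => Fin K) (fun _ => Fin L × Bool)).symm.sum_comp,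
    Fintype.sum_prod_type]
  have h2 : ∀ β : J → Fin K, ∑ c : J → Fin L × Bool,
      totalMix ρ e (fun j => (β j, c j)) ^ 2 / totalMix ρ 0 (fun j => (β j, c j))
      ≤ (∏ b, (1 + t * 6 ^ Fintype.card {j // β j = b})) / (K : ℝ) ^ Fintype.card J := by
    intro β
    have h3 : ∀ c : J → Fin L × Bool,
        totalMix ρ e (fun j => (β j, c j)) ^ 2 / totalMix ρ 0 (fun j => (β j, c j)) =
        (∏ b, (blockMix ρ (fun j : {j // β j = b} => e j) (fiberPiEquiv β c b) ^ 2 /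
          blockMix ρ 0 (fiberPiEquiv β c b))) / (K : ℝ) ^ Fintype.card J := by
      intro c
      rw [totalMix_eq, totalMix_eq, Finset.prod_div_distrib, Finset.prod_pow]
      have hz : ∀ b, (fun j : {j // β j = b} => (0 : J → ℝ) j) = 0 := fun _ => rfl
      simp only [hz]
      change (_ / _) ^ 2 / ((∏ b, blockMix ρ 0 (fiberPiEquiv β c b)) / _) = _
      have hpos : 0 < ∏ b, blockMix ρ 0 (fiberPiEquiv β c b) :=
        Finset.prod_pos fun b _ => blockMix_zero_pos hL h0 h1 _
      change ((∏ b, blockMix ρ (fun j : {j // β j = b} => e j) (fiberPiEquiv β c b)) / _) ^ 2 / _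
        = _
      field_simp
    simp_rw [h3]
    rw [← Finset.sum_div]
    refine div_le_div_of_nonneg_right ?_ (by positivity)
    rw [(fiberPiEquiv β).sum_comp fun d : ∀ b, {j // β j = b} → Fin L × Bool =>
      ∏ b, (blockMix ρ (fun j : {j // β j = b} => e j) (d b) ^ 2 / blockMix ρ 0 (d b))]
    rw [← Fintype.prod_sum fun (b : Fin K) (d : {j // β j = b} → Fin L × Bool) =>
      blockMix ρ (fun j : {j // β j = b} => e j) d ^ 2 / blockMix ρ 0 d]
    refine Finset.prod_le_prod (fun b _ => Finset.sum_nonneg fun d _ =>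
      div_nonneg (sq_nonneg _) (blockMix_zero_pos hL h0 h1 _).le) fun b _ => ?_
    exact sum_blockMix_sq_div_le hL h0 h1 _ η hη0 hη fun j => he j
  calc _ ≤ ∑ β : J → Fin K,
        (∏ b, (1 + t * 6 ^ Fintype.card {j // β j = b})) / (K : ℝ) ^ Fintype.card J :=
        Finset.sum_le_sum fun β _ => h2 β
    _ ≤ _ := by
      rw [← Finset.sum_div, div_le_iff₀ (by positivity), mul_comm]
      exact sum_prod_fiber_pow_le hK hJ ht0

end Total

/-! ### Embedding the cells in `Fin n` -/

section Embedding

variable {D : Type*} [Fintype D] {n : ℕ} {ι : D → Fin n}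

lemma isDist_extend (hι : Function.Injective ι) {p : D → ℝ} (h0 : ∀ d, 0 ≤ p d)
    (h1 : ∑ d, p d = 1) : IsDist (Function.extend ι p 0) := by
  constructor
  · intro i
    by_cases hi : ∃ d, ι d = i
    · obtain ⟨d, rfl⟩ := hi
      rw [hι.extend_apply]
      exact h0 d
    · rw [Function.extend_apply' _ _ _ hi]
      rfl
  · rw [← h1]
    refine (Fintype.sum_of_injective ι hι p _ ?_ ?_).symm
    · intro i hi
      rw [Function.extend_apply' _ _ _ hi]
      rfl
    · intro d
      rw [hι.extend_apply]

lemma tv_extend (hι : Function.Injective ι) (p q : D → ℝ) :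
    tv (Function.extend ι p 0) (Function.extend ι q 0) = (∑ d, |p d - q d|) / 2 := by
  unfold tv
  congr 1
  refine (Fintype.sum_of_injective ι hι _ _ ?_ ?_).symm
  · intro i hi
    rw [Function.extend_apply' _ _ _ hi, Function.extend_apply' _ _ _ hi]
    simp
  · intro d
    rw [hι.extend_apply, hι.extend_apply]

lemma sum_prod_extend [DecidableEq D] (hι : Function.Injective ι) {s : ℕ} (p : D → ℝ)
    (f : (Fin s → Fin n) → ℝ) :
    ∑ x : Fin s → Fin n, (∏ j, Function.extend ι p 0 (x j)) * f x
      = ∑ x : Fin s → D, (∏ j, p (x j)) * f (ι ∘ x) := by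
  refine (Fintype.sum_of_injective (fun x : Fin s → D => ι ∘ x) hι.comp_left _ _ ?_ ?_).symm
  · intro x hx
    have : ∃ j, ¬ ∃ d, ι d = x j := by
      by_contra! h
      choose g hg using h
      exact hx ⟨g, funext hg⟩
    obtain ⟨j, hj⟩ := this
    rw [Finset.prod_eq_zero (Finset.mem_univ j), zero_mul]
    rw [Function.extend_apply' _ _ _ hj]
    rfl
  · intro x
    simp only [Function.comp_apply, hι.extend_apply]

lemma outProb2_extend [DecidableEq D] (hι : Function.Injective ι) {s : ℕ} (p q : D → ℝ)
    (A : (Fin s → Fin n) → (Fin s → Fin n) → Outcome → ℝ) (o : Outcome) :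
    outProb2 (Function.extend ι p 0) (Function.extend ι q 0) A o =
      ∑ w : Fin s ⊕ Fin s → D, (∏ j, Sum.elim (fun _ => p) (fun _ => q) j (w j)) *
        A (fun j => ι (w (Sum.inl j))) (fun j => ι (w (Sum.inr j))) o := by
  unfold outProb2
  rw [← (Equiv.sumArrowEquivProdArrow (Fin s) (Fin s) D).symm.sum_comp, Fintype.sum_prod_type]
  simp_rw [mul_assoc, ← Finset.mul_sum]
  rw [sum_prod_extend hι p fun x => ∑ y : Fin s → Fin n,
    (∏ j, Function.extend ι q 0 (y j)) * A x y o]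
  refine Finset.sum_congr rfl fun x _ => ?_
  rw [sum_prod_extend hι q fun y => A (ι ∘ x) y o, Finset.mul_sum]
  refine Finset.sum_congr rfl fun y _ => ?_
  rw [Fintype.prod_sum_type, ← mul_assoc]
  rfl

end Embedding

lemma sum_outcome (f : Outcome → ℝ) :
    ∑ o, f o = f .accept + f .reject + f .inaccurate := by
  change ∑ o ∈ {Outcome.accept, Outcome.reject, Outcome.inaccurate}, f o = _
  rw [Finset.sum_insert (by decide), Finset.sum_insert (by decide), Finset.sum_singleton, add_assoc]

lemma outProb2_nonneg {n s : ℕ} {p q : Fin n → ℝ} (hp : IsDist p) (hq : IsDist q)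
    {A : (Fin s → Fin n) → (Fin s → Fin n) → Outcome → ℝ} (hA : ∀ x y o, 0 ≤ A x y o)
    (o : Outcome) : 0 ≤ outProb2 p q A o :=
  Finset.sum_nonneg fun x _ => Finset.sum_nonneg fun y _ =>
    mul_nonneg (mul_nonneg (Finset.prod_nonneg fun _ _ => hp.1 _)
      (Finset.prod_nonneg fun _ _ => hq.1 _)) (hA x y o)

lemma sum_outProb2 {n s : ℕ} {p q : Fin n → ℝ} (hp : IsDist p) (hq : IsDist q)
    {A : (Fin s → Fin n) → (Fin s → Fin n) → Outcome → ℝ} (hA : ∀ x y, ∑ o, A x y o = 1) :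
    ∑ o, outProb2 p q A o = 1 := by
  unfold outProb2
  rw [Finset.sum_comm]
  simp_rw [Finset.sum_comm (s := (Finset.univ : Finset Outcome)), ← Finset.mul_sum, hA, mul_one,
    ← Finset.mul_sum]
  rw [← Finset.sum_mul, ← Fintype.prod_sum fun (_ : Fin s) i => p i,
    ← Fintype.prod_sum fun (_ : Fin s) i => q i, hp.2, hq.2]
  simp

/-- A bound on the `χ²` divergence bounds the advantage of any randomized test. -/
lemma sum_mul_le_of_chiSq_le {Ω : Type*} [Fintype Ω] {P Q a : Ω → ℝ} {δ : ℝ} (hP : ∀ w, 0 < P w)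
    (hP1 : ∑ w, P w = 1) (hQ1 : ∑ w, Q w = 1) (ha0 : ∀ w, 0 ≤ a w) (ha1 : ∀ w, a w ≤ 1)
    (hδ : 0 ≤ δ) (h : ∑ w, Q w ^ 2 / P w ≤ 1 + δ ^ 2) :
    ∑ w, P w * a w ≤ ∑ w, Q w * a w + δ := by
  have h1 : (∑ w, (P w - Q w) * a w) ^ 2 ≤
      (∑ w, (P w - Q w) ^ 2 / P w) * ∑ w, P w * a w ^ 2 := by
    refine Finset.sum_sq_le_sum_mul_sum_of_sq_le_mul _
      (fun w _ => div_nonneg (sq_nonneg _) (hP w).le)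
      (fun w _ => mul_nonneg (hP w).le (sq_nonneg _)) fun w _ => le_of_eq ?_
    have := (hP w).ne'
    field_simp
  have h2 : ∑ w, (P w - Q w) ^ 2 / P w ≤ δ ^ 2 := by
    have : ∀ w, (P w - Q w) ^ 2 / P w = Q w ^ 2 / P w - 2 * Q w + P w := by
      intro w
      have := (hP w).ne'
      field_simp
      ring
    simp_rw [this]
    rw [Finset.sum_add_distrib, Finset.sum_sub_distrib, ← Finset.mul_sum, hP1, hQ1]
    linarith
  have h3 : ∑ w, P w * a w ^ 2 ≤ 1 := by
    rw [← hP1]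
    exact Finset.sum_le_sum fun w _ =>
      mul_le_of_le_one_right (hP w).le (pow_le_one₀ (ha0 w) (ha1 w))
  have h4 : (∑ w, (P w - Q w) * a w) ^ 2 ≤ δ ^ 2 := by
    refine h1.trans ((mul_le_mul h2 h3 ?_ (sq_nonneg _)).trans (mul_one _).le)
    exact Finset.sum_nonneg fun w _ => mul_nonneg (hP w).le (sq_nonneg _)
  have h5 := abs_le_of_sq_le_sq h4 hδ
  simp_rw [sub_mul, Finset.sum_sub_distrib] at h5
  linarith [(abs_le.1 h5).2]

/-! ### The hard instances -/

/-- The distribution on cells given by the states of the blocks. -/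
noncomputable def cellDist {K L : ℕ} (e : ℝ) (θ : Fin K → BlockState L)
    (d : Fin K × (Fin L × Bool)) : ℝ :=
  cellMass e (θ d.1) d.2 / K

/-- Prior probability of a family of block states. -/
noncomputable def priorWt {K L : ℕ} (ρ : ℝ) (θ : Fin K → BlockState L) : ℝ :=
  ∏ b, stateWt ρ (θ b)

/-- Number of heavy blocks. -/
noncomputable def heavyCount {K L : ℕ} (θ : Fin K → BlockState L) : ℝ :=
  ∑ b, (θ b).1.elim 0 (fun _ => 1)

section Instances

variable {K L : ℕ}

lemma cellDist_nonneg {e : ℝ} (he : |e| ≤ 1) (θ : Fin K → BlockState L)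
    (d : Fin K × (Fin L × Bool)) : 0 ≤ cellDist e θ d :=
  div_nonneg (cellMass_nonneg he _ _) (by positivity)

lemma sum_cellDist (hK : 0 < K) (hL : 0 < L) (e : ℝ) (θ : Fin K → BlockState L) :
    ∑ d, cellDist e θ d = 1 := by
  have hK' : (0 : ℝ) < K := by exact_mod_cast hK
  rw [Fintype.sum_prod_type]
  simp only [cellDist, ← Finset.sum_div, sum_cellMass hL]
  simp [hK.ne']

lemma sum_priorWt (hL : 0 < L) (ρ : ℝ) : ∑ θ : Fin K → BlockState L, priorWt ρ θ = 1 := by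
  unfold priorWt
  rw [← Fintype.prod_sum fun (_ : Fin K) (θ : BlockState L) => stateWt ρ θ]
  simp [sum_stateWt hL]

lemma priorWt_nonneg {ρ : ℝ} (h0 : 0 ≤ ρ) (h1 : ρ ≤ 1) (θ : Fin K → BlockState L) :
    0 ≤ priorWt ρ θ :=
  Finset.prod_nonneg fun b _ => stateWt_nonneg h0 h1 (θ b)

lemma heavyCount_nonneg (θ : Fin K → BlockState L) : 0 ≤ heavyCount θ := by
  refine Finset.sum_nonneg fun b _ => ?_
  cases (θ b).1 <;> simp

lemma sum_priorWt_mul_heavyCount (hL : 0 < L) (ρ : ℝ) :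
    ∑ θ : Fin K → BlockState L, priorWt ρ θ * heavyCount θ = K * ρ := by
  unfold heavyCount priorWt
  simp_rw [Finset.mul_sum]
  rw [Finset.sum_comm]
  rw [Finset.sum_congr rfl (g := fun _ => ρ)]
  · simp
  intro b _
  have h1 : ∀ θ : Fin K → BlockState L,
      (∏ b, stateWt ρ (θ b)) * (θ b).1.elim 0 (fun _ => 1) =
      ∏ b', (stateWt ρ (θ b') * if b' = b then (θ b').1.elim 0 (fun _ => 1) else 1) := by
    intro θ
    rw [Finset.prod_mul_distrib, Finset.prod_ite_eq' Finset.univ b]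
    simp
  simp_rw [h1]
  rw [← Fintype.prod_sum fun (b' : Fin K) (θ : BlockState L) =>
    stateWt ρ θ * if b' = b then θ.1.elim 0 (fun _ => 1) else 1]
  rw [Finset.prod_eq_single b]
  · simp only [if_true]
    rw [sum_stateWt_mul hL]
    ring
  · intro b' _ hb'
    simp only [if_neg hb', mul_one]
    exact sum_stateWt hL ρ
  · simp

/-- With the right prior, at most an `α`-fraction of the blocks is heavy, with probability at least
`7/8`. -/
lemma le_sum_priorWt_filter (hK : 0 < K) (hL : 0 < L) {α : ℝ} (h0 : 0 < α) (h1 : α ≤ 1) :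
    7 / 8 ≤ ∑ θ : Fin K → BlockState L with heavyCount θ ≤ α * K, priorWt (α / 8) θ := by
  have hK' : (0 : ℝ) < K := by exact_mod_cast hK
  have hw := priorWt_nonneg (K := K) (L := L) (ρ := α / 8) (by positivity) (by linarith)
  have hsum := Finset.sum_filter_add_sum_filter_not (Finset.univ : Finset (Fin K → BlockState L))
    (fun θ => heavyCount θ ≤ α * K) (fun θ => priorWt (α / 8) θ)
  rw [sum_priorWt hL] at hsum
  have hbad : (∑ θ : Fin K → BlockState L with ¬ heavyCount θ ≤ α * K, priorWt (α / 8) θ) *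
      (α * K) ≤ K * (α / 8) := by
    rw [← sum_priorWt_mul_heavyCount hL, Finset.sum_mul]
    calc _ ≤ ∑ θ : Fin K → BlockState L with ¬ heavyCount θ ≤ α * K,
          priorWt (α / 8) θ * heavyCount θ := by
          refine Finset.sum_le_sum fun θ hθ => ?_
          exact mul_le_mul_of_nonneg_left (not_le.1 (Finset.mem_filter.1 hθ).2).le (hw θ)
      _ ≤ _ := Finset.sum_le_sum_of_subset_of_nonneg (Finset.filter_subset _ _)
          fun θ _ _ => mul_nonneg (hw θ) (heavyCount_nonneg θ)
  have : (∑ θ : Fin K → BlockState L with ¬ heavyCount θ ≤ α * K, priorWt (α / 8) θ) ≤ 1 / 8 := by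
    refine le_of_mul_le_mul_right (hbad.trans (le_of_eq ?_)) (mul_pos h0 hK')
    ring
  linarith

lemma sum_abs_cellMass_sub_light_le (hL : 0 < L) (θ : BlockState L) (σ : Fin L → Bool) :
    ∑ c, |cellMass 0 θ c - cellMass 0 (none, σ) c| ≤ 2 * θ.1.elim 0 (fun _ => 1) := by
  obtain ⟨_ | h, τ⟩ := θ
  · simp [cellMass]
  · calc _ ≤ ∑ c, (cellMass 0 (some h, τ) c + cellMass 0 (none, σ) c) := by
          refine Finset.sum_le_sum fun c _ => ?_
          refine (abs_sub _ _).trans (le_of_eq ?_)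
          rw [abs_of_nonneg (cellMass_nonneg (by simp) _ _),
            abs_of_nonneg (cellMass_nonneg (by simp) _ _)]
      _ = _ := by
          rw [Finset.sum_add_distrib, sum_cellMass hL, sum_cellMass hL]
          norm_num

lemma sum_abs_cellMass_sub (hL : 0 < L) {η : ℝ} (hη : 0 ≤ η) (θ : BlockState L) :
    ∑ c, |cellMass 0 θ c - cellMass η θ c| = η * (1 - θ.1.elim 0 (fun _ => 1)) := by
  have hL' : (0 : ℝ) < L := by exact_mod_cast hL
  obtain ⟨_ | h, σ⟩ := θ
  · have : ∀ c : Fin L × Bool,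
        |cellMass 0 (none, σ) c - cellMass η (none, σ) c| = η / (2 * L) := by
      intro c
      simp only [cellMass, Option.elim]
      rw [← sub_div, abs_div, abs_of_pos (by positivity : (0 : ℝ) < 2 * L), zero_mul, zero_mul,
        add_zero, sub_add_cancel_left, abs_neg, abs_mul_boolSign_mul, abs_of_nonneg hη]
    simp_rw [this]
    simp
    field_simp
  · simp [cellMass]

lemma sum_abs_cellDist_sub_light_le (hK : 0 < K) (hL : 0 < L) (θ : Fin K → BlockState L)
    (σ : Fin L → Bool) :
    (∑ d, |cellDist 0 θ d - cellDist 0 (fun _ => (none, σ)) d|) / 2 ≤ heavyCount θ / K := by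
  have hK' : (0 : ℝ) < K := by exact_mod_cast hK
  rw [Fintype.sum_prod_type]
  simp only [cellDist, ← sub_div, abs_div, abs_of_pos hK', ← Finset.sum_div]
  rw [div_right_comm]
  refine div_le_div_of_nonneg_right ?_ hK'.le
  rw [div_le_iff₀ two_pos, mul_comm, heavyCount, Finset.mul_sum]
  exact Finset.sum_le_sum fun b _ => sum_abs_cellMass_sub_light_le hL (θ b) σ

lemma sum_abs_cellDist_sub (hK : 0 < K) (hL : 0 < L) {η : ℝ} (hη : 0 ≤ η)
    (θ : Fin K → BlockState L) :
    ∑ d, |cellDist 0 θ d - cellDist η θ d| = η * (1 - heavyCount θ / K) := by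
  have hK' : (0 : ℝ) < K := by exact_mod_cast hK
  rw [Fintype.sum_prod_type]
  simp only [cellDist, ← sub_div, abs_div, abs_of_pos hK', ← Finset.sum_div,
    sum_abs_cellMass_sub hL hη]
  rw [← Finset.mul_sum, Finset.sum_sub_distrib, ← heavyCount]
  simp
  field_simp

lemma totalMix_eq_sum {J : Type*} [Fintype J] (ρ : ℝ) (e : J → ℝ)
    (w : J → Fin K × (Fin L × Bool)) :
    totalMix ρ e w = ∑ θ, priorWt ρ θ * ∏ j, cellDist (e j) θ (w j) := rfl

lemma sum_totalMix {J : Type*} [Fintype J] [DecidableEq J] (hK : 0 < K) (hL : 0 < L) (ρ : ℝ)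
    (e : J → ℝ) : ∑ w : J → Fin K × (Fin L × Bool), totalMix ρ e w = 1 := by
  simp_rw [totalMix_eq_sum]
  rw [Finset.sum_comm]
  simp_rw [← Finset.mul_sum]
  rw [← sum_priorWt (K := K) hL ρ]
  refine Finset.sum_congr rfl fun θ _ => ?_
  rw [← Fintype.prod_sum fun (j : J) (d : Fin K × (Fin L × Bool)) => cellDist (e j) θ d]
  simp_rw [sum_cellDist hK hL]
  simp

lemma sum_totalMix_mul {n s : ℕ} {ι : Fin K × (Fin L × Bool) → Fin n}
    (hι : Function.Injective ι) (ρ η : ℝ)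
    (A : (Fin s → Fin n) → (Fin s → Fin n) → Outcome → ℝ) (o : Outcome) :
    ∑ w, totalMix ρ (Sum.elim (fun _ : Fin s => 0) (fun _ : Fin s => η)) w *
        A (fun j => ι (w (Sum.inl j))) (fun j => ι (w (Sum.inr j))) o =
      ∑ θ, priorWt ρ θ * outProb2 (Function.extend ι (cellDist 0 θ) 0)
        (Function.extend ι (cellDist η θ) 0) A o := by
  simp_rw [totalMix_eq_sum, outProb2_extend hι, Finset.sum_mul, Finset.mul_sum]
  rw [Finset.sum_comm]
  refine Finset.sum_congr rfl fun θ _ => Finset.sum_congr rfl fun w _ => ?_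
  rw [mul_assoc]
  congr 2
  refine Finset.prod_congr rfl fun j _ => ?_
  cases j <;> rfl

end Instances

/-- The family of hard pairs: equal pairs and perturbed pairs, over all block states in which at
most an `α`-fraction of the blocks is heavy. -/
def hardPairs {K L n : ℕ} (ι : Fin K × (Fin L × Bool) → Fin n) (α η : ℝ) :
    Set ((Fin n → ℝ) × (Fin n → ℝ)) :=
  {pq | ∃ θ : Fin K → BlockState L, heavyCount θ ≤ α * K ∧ ∃ e, (e = 0 ∨ e = η) ∧
    pq = (Function.extend ι (cellDist 0 θ) 0, Function.extend ι (cellDist e θ) 0)}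

section HardPairs

variable {K L n : ℕ} {ι : Fin K × (Fin L × Bool) → Fin n}

lemma isDist_extend_cellDist (hι : Function.Injective ι) (hK : 0 < K) (hL : 0 < L) {e : ℝ}
    (he : |e| ≤ 1) (θ : Fin K → BlockState L) :
    IsDist (Function.extend ι (cellDist e θ) 0) :=
  isDist_extend hι (cellDist_nonneg he θ) (sum_cellDist hK hL e θ)

lemma tv_extend_light_le (hι : Function.Injective ι) (hK : 0 < K) (hL : 0 < L) {α : ℝ}
    {θ : Fin K → BlockState L} (hθ : heavyCount θ ≤ α * K) (σ : Fin L → Bool) :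
    tv (Function.extend ι (cellDist 0 θ) 0)
      (Function.extend ι (cellDist 0 fun _ : Fin K => (none, σ)) 0) ≤ α := by
  have hK' : (0 : ℝ) < K := by exact_mod_cast hK
  rw [tv_extend hι]
  exact (sum_abs_cellDist_sub_light_le hK hL θ σ).trans ((div_le_iff₀ hK').2 hθ)

lemma tv_comm {n : ℕ} (p q : Fin n → ℝ) : tv p q = tv q p := by
  simp only [tv, abs_sub_comm]

/-- No algorithm with few samples is valid on all the hard pairs. -/
theorem not_valid_of_few_samples (hι : Function.Injective ι) (hK : 0 < K) (hL : 0 < L)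
    {ε α : ℝ} (hε1 : ε < 1 / 6) (hα0 : 0 < α) (hα : α < ε) {s : ℕ} (hs : 2 * s ≤ K)
    (hχ : K * ((3 * ε) ^ 4 / (α / 8 * L ^ 2) * Real.exp 5) ≤ 1 / 200) (σ : Fin L → Bool)
    (A : (Fin s → Fin n) → (Fin s → Fin n) → Outcome → ℝ)
    (hA0 : ∀ x y o, 0 ≤ A x y o) (hA1 : ∀ x y, ∑ o, A x y o = 1)
    (hA : ∀ pq ∈ hardPairs ι α (3 * ε),
      (tv (Function.extend ι (cellDist 0 fun _ : Fin K => (none, σ)) 0) pq.1 ≤ α →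
        outProb2 pq.1 pq.2 A Outcome.inaccurate ≤ (11/24) / 2) ∧
      (pq.1 = pq.2 → outProb2 pq.1 pq.2 A Outcome.reject ≤ (11/24) / 2) ∧
      (ε < tv pq.1 pq.2 → outProb2 pq.1 pq.2 A Outcome.accept ≤ (11/24) / 2)) : False := by
  classical
  have hK' : (0 : ℝ) < K := by exact_mod_cast hK
  have hε0 : 0 < ε := hα0.trans hα
  have hη : |3 * ε| ≤ 1 := by rw [abs_of_pos (by positivity)]; linarith
  have hd0 := isDist_extend_cellDist hι hK hL (e := 0) (by simp)
  have hdη := isDist_extend_cellDist hι hK hL hη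
  have hw := priorWt_nonneg (K := K) (L := L) (ρ := α / 8) (by positivity) (by linarith)
  have hyes : ∀ θ : Fin K → BlockState L, heavyCount θ ≤ α * K →
      13 / 24 ≤ outProb2 (Function.extend ι (cellDist 0 θ) 0)
        (Function.extend ι (cellDist 0 θ) 0) A .accept := by
    intro θ hθ
    obtain ⟨h1, h2, -⟩ := hA (_, _) ⟨θ, hθ, 0, Or.inl rfl, rfl⟩
    have h1 := h1 (by rw [tv_comm]; exact tv_extend_light_le hι hK hL hθ σ)
    have h2 := h2 rfl
    have h3 := sum_outProb2 (hd0 θ) (hd0 θ) hA1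
    rw [sum_outcome] at h3
    simp only at h1 h2
    linarith
  have hno : ∀ θ : Fin K → BlockState L, heavyCount θ ≤ α * K →
      outProb2 (Function.extend ι (cellDist 0 θ) 0)
        (Function.extend ι (cellDist (3 * ε) θ) 0) A .accept ≤ 11 / 48 := by
    intro θ hθ
    obtain ⟨-, -, h3⟩ := hA (_, _) ⟨θ, hθ, 3 * ε, Or.inr rfl, rfl⟩
    refine (h3 ?_).trans (by norm_num)
    simp only
    rw [tv_extend hι, sum_abs_cellDist_sub hK hL (by positivity)]
    have : heavyCount θ / K ≤ α := (div_le_iff₀ hK').2 hθ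
    nlinarith
  have hle1 : ∀ θ : Fin K → BlockState L, outProb2 (Function.extend ι (cellDist 0 θ) 0)
        (Function.extend ι (cellDist (3 * ε) θ) 0) A .accept ≤ 1 := by
    intro θ
    rw [← sum_outProb2 (hd0 θ) (hdη θ) hA1]
    exact Finset.single_le_sum (f := outProb2 _ _ A)
      (fun o _ => outProb2_nonneg (hd0 θ) (hdη θ) hA0 o) (Finset.mem_univ _)
  set G : Finset (Fin K → BlockState L) := {θ | heavyCount θ ≤ α * K} with hG
  set g := ∑ θ ∈ G, priorWt (α / 8) θ with hg
  have hg78 : 7 / 8 ≤ g := le_sum_priorWt_filter hK hL hα0 (by linarith)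
  have hP : 13 / 24 * g ≤ ∑ θ, priorWt (α / 8) θ *
      outProb2 (Function.extend ι (cellDist 0 θ) 0)
        (Function.extend ι (cellDist 0 θ) 0) A .accept := by
    rw [hg, Finset.mul_sum]
    calc _ ≤ ∑ θ ∈ G, priorWt (α / 8) θ *
            outProb2 (Function.extend ι (cellDist 0 θ) 0)
              (Function.extend ι (cellDist 0 θ) 0) A .accept := by
          refine Finset.sum_le_sum fun θ hθ => ?_
          rw [mul_comm]
          exact mul_le_mul_of_nonneg_left (hyes θ (Finset.mem_filter.1 hθ).2) (hw θ)
      _ ≤ _ := Finset.sum_le_sum_of_subset_of_nonneg (Finset.subset_univ _)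
          fun θ _ _ => mul_nonneg (hw θ) (outProb2_nonneg (hd0 θ) (hd0 θ) hA0 _)
  have hQ : ∑ θ, priorWt (α / 8) θ * outProb2 (Function.extend ι (cellDist 0 θ) 0)
        (Function.extend ι (cellDist (3 * ε) θ) 0) A .accept ≤ 11 / 48 * g + (1 - g) := by
    have hsum := Finset.sum_filter_add_sum_filter_not
      (Finset.univ : Finset (Fin K → BlockState L))
      (fun θ => heavyCount θ ≤ α * K) (fun θ => priorWt (α / 8) θ)
    rw [sum_priorWt hL, ← hG, ← hg] at hsum
    rw [← Finset.sum_filter_add_sum_filter_not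
      (Finset.univ : Finset (Fin K → BlockState L)) (fun θ => heavyCount θ ≤ α * K), ← hG]
    refine add_le_add ?_ ?_
    · rw [hg, Finset.mul_sum]
      refine Finset.sum_le_sum fun θ hθ => ?_
      rw [mul_comm]
      exact mul_le_mul_of_nonneg_right (hno θ (Finset.mem_filter.1 hθ).2) (hw θ)
    · rw [← eq_sub_of_add_eq' hsum]
      exact Finset.sum_le_sum fun θ _ => mul_le_of_le_one_right (hw θ) (hle1 θ)
  have h_elim : Sum.elim (fun _ : Fin s => (0 : ℝ)) (fun _ : Fin s => 0) = fun _ => 0 :=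
    Sum.elim_lam_const_lam_const 0
  have key := sum_mul_le_of_chiSq_le (δ := 1 / 10)
    (P := totalMix (K := K) (L := L) (α / 8) (Sum.elim (fun _ : Fin s => 0) (fun _ : Fin s => 0)))
    (Q := totalMix (K := K) (L := L) (α / 8)
      (Sum.elim (fun _ : Fin s => 0) (fun _ : Fin s => 3 * ε)))
    (a := fun w => A (fun j => ι (w (Sum.inl j))) (fun j => ι (w (Sum.inr j))) .accept)
    (by
      rw [h_elim]
      exact totalMix_zero_pos hK hL (by positivity) (by linarith))
    (sum_totalMix hK hL _ _) (sum_totalMix hK hL _ _) (fun w => hA0 _ _ _)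
    (fun w => by
      rw [← hA1 (fun j => ι (w (Sum.inl j))) (fun j => ι (w (Sum.inr j)))]
      exact Finset.single_le_sum (fun o _ => hA0 _ _ o) (Finset.mem_univ _))
    (by norm_num)
    (by
      rw [h_elim]
      refine (sum_totalMix_sq_div_le hK hL (by simpa [← two_mul] using hs) (by positivity)
        (by linarith) _ (3 * ε) (by positivity) (by linarith) ?_).trans ?_
      · rintro (j | j)
        · simp; positivity
        · simp [abs_of_pos hε0]
      · set x := (3 * ε) ^ 4 / (α / 8 * L ^ 2) * Real.exp 5 with hx
        have hx0 : 0 ≤ x := by positivity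
        have h1 : (1 + x) ^ K ≤ Real.exp (K * x) := by
          rw [Real.exp_nat_mul]
          refine pow_le_pow_left₀ (by positivity) ?_ _
          linarith [Real.add_one_le_exp x]
        have hKx : 0 ≤ K * x := by positivity
        have h2 := Real.abs_exp_sub_one_le (x := K * x)
          (by rw [abs_of_nonneg hKx]; linarith)
        rw [abs_of_nonneg hKx] at h2
        have := (abs_le.1 h2).2
        linarith)
  rw [sum_totalMix_mul hι, sum_totalMix_mul hι] at key
  linarith

end HardPairs

lemma sampleBound_pow_three {n ε α : ℝ} (hn : 0 ≤ n) (hε : 0 ≤ ε) (hα : 0 ≤ α) :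
    (n ^ ((2:ℝ)/3) * α ^ ((1:ℝ)/3) / ε ^ ((4:ℝ)/3)) ^ 3 = n ^ 2 * α / ε ^ 4 := by
  rw [div_pow, mul_pow, ← Real.rpow_natCast, ← Real.rpow_natCast, ← Real.rpow_natCast,
    ← Real.rpow_mul hn, ← Real.rpow_mul hα, ← Real.rpow_mul hε]
  norm_num

/-- lower bound for augmented closeness testing when
`(√n·ε²)⁻¹ < α < ε`: there is an absolute constant `c > 0` such that for every
positive `n`, `ε ∈ (0,1/6)` and `α ∈ ((√n·ε²)⁻¹, ε)`, there exist a prediction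
`phat` and a family `F` of pairs of distributions `(p, q)` on `Fin n` with
`tv(p − phat) ≤ α`, such that any randomized algorithm (given `phat`, `s` samples
from `p` and `s` samples from `q`) whose outputs satisfy the validity conditions
of an `(α, ε, 11/24)`-augmented closeness tester on all pairs of `F` must draw at
least `c·n^{2/3}·α^{1/3}/ε^{4/3}` samples in total (here `2s`). -/
theorem stmt9 :
    ∃ c : ℝ, 0 < c ∧
      ∀ (n : ℕ), 0 < n → ∀ (ε α : ℝ), ε ∈ Set.Ioo (0:ℝ) (1/6) →
        1 / (Real.sqrt n * ε ^ 2) < α → α < ε →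
        ∃ phat : Fin n → ℝ, IsDist phat ∧
        ∃ F : Set ((Fin n → ℝ) × (Fin n → ℝ)),
          (∀ pq ∈ F, IsDist pq.1 ∧ IsDist pq.2 ∧ tv pq.1 phat ≤ α) ∧
          ∀ (s : ℕ) (A : (Fin s → Fin n) → (Fin s → Fin n) → Outcome → ℝ),
            (∀ x y o, 0 ≤ A x y o) → (∀ x y, ∑ o, A x y o = 1) →
            (∀ pq ∈ F,
              (tv phat pq.1 ≤ α →
                outProb2 pq.1 pq.2 A Outcome.inaccurate ≤ (11/24) / 2) ∧
              (pq.1 = pq.2 → outProb2 pq.1 pq.2 A Outcome.reject ≤ (11/24) / 2) ∧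
              (ε < tv pq.1 pq.2 →
                outProb2 pq.1 pq.2 A Outcome.accept ≤ (11/24) / 2)) →
            c * ((n : ℝ) ^ ((2:ℝ)/3) * α ^ ((1:ℝ)/3) / ε ^ ((4:ℝ)/3)) ≤ (2 * s : ℝ) := by
  refine ⟨1 / 2000, by norm_num, ?_⟩
  rintro n hn ε α ⟨hε0, hε1⟩ hα1 hα2
  have hn' : (1 : ℝ) ≤ n := by exact_mod_cast hn
  set r := Real.sqrt n with hr
  have hrn : r ^ 2 = n := Real.sq_sqrt (by positivity)
  have hr0 : 0 < r := Real.sqrt_pos.2 (by linarith)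
  have hα0 : 0 < α := lt_trans (by positivity) hα1
  have hrα : 1 < r * α * ε ^ 2 := by
    rw [div_lt_iff₀ (by positivity)] at hα1
    linarith
  have hrε : 1 < r * ε ^ 3 := by
    refine hrα.trans ?_
    calc r * α * ε ^ 2 < r * ε * ε ^ 2 := by gcongr
      _ = r * ε ^ 3 := by ring
  set S := (n : ℝ) ^ ((2:ℝ)/3) * α ^ ((1:ℝ)/3) / ε ^ ((4:ℝ)/3) with hS
  have hS0 : 0 < S := by positivity
  have hS3 : S ^ 3 = n ^ 2 * α / ε ^ 4 :=
    sampleBound_pow_three (by positivity) hε0.le hα0.le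
  have hS_large : 2000 ≤ S := by
    refine le_of_pow_le_pow_left₀ (n := 3) (by norm_num) hS0.le ?_
    rw [hS3, le_div_iff₀ (by positivity)]
    have h6 : (6 * ε) ^ 15 ≤ 1 := pow_le_one₀ (by positivity) (by linarith)
    have h1 : 1 ≤ (r * ε ^ 3) ^ 3 := one_le_pow₀ hrε.le
    have h2 : 1 ≤ (r * ε ^ 3) ^ 3 * (r * α * ε ^ 2) := by nlinarith
    have h3 : n ^ 2 * α * ε ^ 11 = (r * ε ^ 3) ^ 3 * (r * α * ε ^ 2) := by
      rw [← hrn]; ring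
    have h4 : (2000 : ℝ) ^ 3 * ε ^ 15 ≤ 1 := by
      refine le_trans ?_ h6
      rw [mul_pow]
      gcongr
      norm_num
    have h5 : (2000 : ℝ) ^ 3 * ε ^ 4 * ε ^ 11 ≤ n ^ 2 * α * ε ^ 11 := by
      calc _ = (2000 : ℝ) ^ 3 * ε ^ 15 := by ring
        _ ≤ _ := by linarith
    exact le_of_mul_le_mul_right h5 (by positivity)
  have hSn : S ≤ n := by
    refine le_of_pow_le_pow_left₀ (n := 3) (by norm_num) (by positivity) ?_
    rw [hS3, div_le_iff₀ (by positivity)]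
    have h1 : 1 ≤ n * ε ^ 3 := by
      have : r ≤ n := by
        rw [← hrn]
        nlinarith [pow_le_one₀ hε0.le (by linarith : ε ≤ 1) (n := 3)]
      exact hrε.le.trans (by gcongr)
    calc (n : ℝ) ^ 2 * α ≤ n ^ 2 * ε * 1 := by rw [mul_one]; gcongr
      _ ≤ n ^ 2 * ε * (n * ε ^ 3) := by gcongr
      _ = _ := by ring
  set K := ⌈1 / 2000 * S⌉₊ with hKdef
  have hKge : 1 / 2000 * S ≤ K := Nat.le_ceil _
  have hKle : (K : ℝ) ≤ 1 / 1000 * S := by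
    have := (Nat.ceil_lt_add_one (by positivity : 0 ≤ 1 / 2000 * S)).le
    linarith
  have hK : 0 < K := Nat.ceil_pos.2 (by positivity)
  have hK' : (0 : ℝ) < K := by exact_mod_cast hK
  set L := n / (2 * K) with hLdef
  have h2K : 2 * K ≤ n := by
    have : (2 * K : ℝ) ≤ n := by linarith
    exact_mod_cast this
  have hL : 0 < L := Nat.div_pos h2K (by positivity)
  have hL' : (1 : ℝ) ≤ L := by exact_mod_cast hL
  have hKL : K * (L * 2) ≤ n := by
    calc K * (L * 2) = n / (2 * K) * (2 * K) := by ring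
      _ ≤ n := Nat.div_mul_le_self _ _
  have hnL : (n : ℝ) ≤ 4 * K * L := by
    have h1 : n < 2 * K * (L + 1) := Nat.lt_mul_div_succ n (by positivity)
    have h2 : (n : ℝ) < 2 * K * (L + 1) := by exact_mod_cast h1
    nlinarith
  obtain ⟨ι⟩ : Nonempty (Fin K × (Fin L × Bool) ↪ Fin n) :=
    Function.Embedding.nonempty_of_card_le (by simpa using hKL)
  have hι : Function.Injective ι := ι.injective
  set phat : Fin n → ℝ := Function.extend ι (cellDist 0 fun _ : Fin K => (none, fun _ => true)) 0
  refine ⟨phat, isDist_extend_cellDist hι hK hL (by simp) _, hardPairs ι α (3 * ε), ?_, ?_⟩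
  · rintro pq ⟨θ, hθ, e, he, rfl⟩
    refine ⟨isDist_extend_cellDist hι hK hL (by simp) _, isDist_extend_cellDist hι hK hL ?_ _,
      tv_extend_light_le hι hK hL hθ _⟩
    rcases he with rfl | rfl
    · simp
    · rw [abs_of_pos (by positivity)]; linarith
  · intro s A hA0 hA1 hA
    by_contra! hlt
    refine not_valid_of_few_samples hι hK hL hε1 hα0 hα2 (s := s) ?_ ?_ _ A hA0 hA1 hA
    · have : (2 * s : ℝ) ≤ K := hlt.le.trans hKge
      exact_mod_cast this
    · have hexp : Real.exp 5 ≤ 243 := by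
        have : Real.exp 5 = Real.exp 1 ^ 5 := by rw [← Real.exp_nat_mul]; norm_num
        rw [this]
        calc _ ≤ (3 : ℝ) ^ 5 := by
              gcongr
              linarith [Real.exp_one_lt_d9]
          _ = 243 := by norm_num
      have hK3 : (K : ℝ) ^ 3 * ε ^ 4 ≤ 1 / 1000 ^ 3 * (n ^ 2 * α) := by
        calc (K : ℝ) ^ 3 * ε ^ 4 ≤ (1 / 1000 * S) ^ 3 * ε ^ 4 := by gcongr
          _ = 1 / 1000 ^ 3 * (n ^ 2 * α) := by rw [mul_pow, hS3]; field_simp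
      have hn2 : (n : ℝ) ^ 2 ≤ 16 * K ^ 2 * L ^ 2 := by
        calc (n : ℝ) ^ 2 ≤ (4 * K * L) ^ 2 := by gcongr
          _ = _ := by ring
      have h1 : (K : ℝ) * ε ^ 4 ≤ 16 / 1000 ^ 3 * (α * L ^ 2) := by
        refine le_of_mul_le_mul_right (a := (K : ℝ) ^ 2) ?_ (by positivity)
        calc (K : ℝ) * ε ^ 4 * K ^ 2 = K ^ 3 * ε ^ 4 := by ring
          _ ≤ 1 / 1000 ^ 3 * (n ^ 2 * α) := hK3
          _ ≤ 1 / 1000 ^ 3 * (16 * K ^ 2 * L ^ 2 * α) := by gcongr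
          _ = _ := by ring
      calc K * ((3 * ε) ^ 4 / (α / 8 * L ^ 2) * Real.exp 5)
          ≤ K * ((3 * ε) ^ 4 / (α / 8 * L ^ 2) * 243) := by gcongr
        _ = 157464 * (K * ε ^ 4) / (α * L ^ 2) := by field_simp; ring
        _ ≤ 157464 * (16 / 1000 ^ 3 * (α * L ^ 2)) / (α * L ^ 2) := by gcongr
        _ = 157464 * 16 / 1000 ^ 3 := by field_simp
        _ ≤ 1 / 200 := by norm_num
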